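/- Concentration on the critical curve for general homomorphism densities (Theorem 3.4): Let H be a fixed finite simple graph with E(H) edges. Assume α > −2 and that g_{α,h} attains its maximum over [0,1] at exactly two points 0 < u₁* < u₂* < 1. Then for all sufficiently small ε > 0 there exist τ > 0 and N ∈ ℕ such that for all n ≥ N, ℙ_{n;α,h}( { x ∈ 𝒜_n : t(H, x) ∈ J(ε) } ) ≥ 1 − exp(−τ·n²), where J(ε) = ((u₁*)^{E(H)}−ε, (u₁*)^{E(H)}+ε) ∪ ((u₂*)^{E(H)}−ε, (u₂*)^{E(H)}+ε). -/

import Mathlib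

open scoped Classical

/-- Number of triangles in the graph `G` on `n` vertices. -/
noncomputable def triCount {n : ℕ} (G : SimpleGraph (Fin n)) : ℕ :=
  Nat.card {s : Finset (Fin n) // G.IsNClique 3 s}

/-- Number of edges of `G`. -/
noncomputable def edgeCount {n : ℕ} (G : SimpleGraph (Fin n)) : ℕ :=
  Nat.card G.edgeSet

/-- Gibbs weight `exp((α/n)·T_n(G) + h·E_n(G))` of the edge-triangle model. -/
noncomputable def gibbsWeight (α h : ℝ) {n : ℕ} (G : SimpleGraph (Fin n)) : ℝ :=
  Real.exp (α / n * triCount G + h * edgeCount G)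

/-- The edge-triangle Gibbs probability of a set `A` of graphs on `n` vertices. -/
noncomputable def gibbsProb (α h : ℝ) (n : ℕ) (A : Set (SimpleGraph (Fin n))) : ℝ :=
  (∑ G : SimpleGraph (Fin n), if G ∈ A then gibbsWeight α h G else 0) /
  (∑ G : SimpleGraph (Fin n), gibbsWeight α h G)

/-- The energy function `g_{α,h}(u) = (α/6)u³ + (h/2)u − I(u)/2`. -/
noncomputable def gFun (α h u : ℝ) : ℝ :=
  α / 6 * u ^ 3 + h / 2 * u - (u * Real.log u + (1 - u) * Real.log (1 - u)) / 2

/-- The homomorphism density `t(H,G) = hom(H,G) / n^{v(H)}`. -/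
noncomputable def homDensity {V : Type} [Fintype V] (H : SimpleGraph V) {n : ℕ}
    (G : SimpleGraph (Fin n)) : ℝ :=
  (Nat.card (H →g G) : ℝ) / (n : ℝ) ^ (Fintype.card V)

/-- The number of edges of a finite simple graph `H`. -/
noncomputable def edgeNum {V : Type} (H : SimpleGraph V) : ℕ := Nat.card H.edgeSet

/-- The real adjacency matrix of a graph. -/
noncomputable def adjReal {n : ℕ} (G : SimpleGraph (Fin n)) (i j : Fin n) : ℝ :=
  if G.Adj i j then 1 else 0

/-- The off-diagonal unordered pairs of vertices. -/
noncomputable def offDiagPairs (n : ℕ) : Finset (Sym2 (Fin n)) :=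
  Finset.univ.filter fun e => ¬ e.IsDiag

lemma adjReal_eq_indicator {n : ℕ} (G : SimpleGraph (Fin n)) (i j : Fin n) :
    adjReal G i j = if s(i, j) ∈ G.edgeSet then 1 else 0 := by
  simp [adjReal, SimpleGraph.mem_edgeSet]

lemma sum_sum_sym2_mk {n : ℕ} (f : Sym2 (Fin n) → ℝ) :
    ∑ i, ∑ j, f s(i, j) = 2 * ∑ e ∈ offDiagPairs n, f e + ∑ i, f s(i, i) := by
  have key : ∑ e ∈ offDiagPairs n, f e
      = ∑ q : Fin n × Fin n, if q.1 < q.2 then f s(q.1, q.2) else 0 := by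
    have := Finset.sum_sym2_filter_not_isDiag (Finset.univ : Finset (Fin n)) f
    rw [← Finset.sum_filter, offDiagPairs]
    rw [Finset.sym2_univ] at this
    convert this using 2
    ext q
    simp only [Finset.mem_filter, Finset.mem_univ, true_and, Finset.mem_offDiag]
    exact ⟨fun h => ⟨h.ne, h⟩, fun h => h.2⟩
  rw [key, two_mul]
  have swap : ∑ q : Fin n × Fin n, (if q.1 < q.2 then f s(q.1, q.2) else 0)
      = ∑ q : Fin n × Fin n, if q.2 < q.1 then f s(q.1, q.2) else 0 := by
    refine Fintype.sum_equiv (Equiv.prodComm _ _) _ _ fun q => ?_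
    simp [Sym2.eq_swap]
  have diag : ∑ i : Fin n, f s(i, i)
      = ∑ q : Fin n × Fin n, if q.1 = q.2 then f s(q.1, q.2) else 0 := by
    rw [Fintype.sum_prod_type]
    simp
  nth_rewrite 2 [swap]
  rw [diag, ← Fintype.sum_prod_type', ← Finset.sum_add_distrib, ← Finset.sum_add_distrib]
  refine Finset.sum_congr rfl fun q _ => ?_
  rcases lt_trichotomy q.1 q.2 with h | h | h
  · simp [h, h.ne, h.not_gt]
  · simp [h]
  · simp [h, h.ne', h.not_gt]

lemma sum_graph_prod_ite {n : ℕ} (q r : Sym2 (Fin n) → ℝ) :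
    ∑ G : SimpleGraph (Fin n), ∏ e ∈ offDiagPairs n, (if e ∈ G.edgeSet then q e else r e)
      = ∏ e ∈ offDiagPairs n, (q e + r e) := by
  rw [Finset.prod_add]
  have hsub : ∀ (G : SimpleGraph (Fin n)) (e), e ∈ G.edgeSet → e ∈ offDiagPairs n := by
    intro G e he
    simpa [offDiagPairs] using G.not_isDiag_of_mem_edgeSet he
  refine Finset.sum_bij' (fun G _ => (offDiagPairs n).filter fun e => e ∈ G.edgeSet)
    (fun t _ => SimpleGraph.fromEdgeSet (t : Set (Sym2 (Fin n)))) ?_ ?_ ?_ ?_ ?_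
  · intro G _
    exact Finset.mem_powerset.2 (Finset.filter_subset _ _)
  · intro t _
    exact Finset.mem_univ _
  · intro G _
    rw [← SimpleGraph.edgeSet_inj, SimpleGraph.edgeSet_fromEdgeSet]
    ext e
    have h1 := hsub G e
    have h2 : e ∈ G.edgeSet → ¬ e.IsDiag := G.not_isDiag_of_mem_edgeSet
    simp only [Finset.coe_filter, Set.mem_sdiff, Set.mem_ofPred_eq, Sym2.mem_diagSet]
    tauto
  · intro t ht
    ext e
    have := @Finset.mem_powerset.1 ht e
    simp only [offDiagPairs, Finset.mem_filter, Finset.mem_univ, true_and] at this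
    simp only [offDiagPairs, Finset.mem_filter, Finset.mem_univ, true_and,
      SimpleGraph.edgeSet_fromEdgeSet, Set.mem_sdiff, Finset.mem_coe, Sym2.mem_diagSet]
    tauto
  · intro G _
    rw [Finset.prod_ite]
    congr 2
    ext e
    simp only [Finset.mem_filter, Finset.mem_sdiff]
    tauto

lemma sum_sum_adjReal {n : ℕ} (G : SimpleGraph (Fin n)) :
    ∑ i, ∑ j, adjReal G i j = 2 * (edgeCount G : ℝ) := by
  simp_rw [adjReal_eq_indicator]
  rw [sum_sum_sym2_mk (fun e => if e ∈ G.edgeSet then (1 : ℝ) else 0)]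
  have h0 : ∑ i : Fin n, (if s(i, i) ∈ G.edgeSet then (1 : ℝ) else 0) = 0 := by simp
  rw [h0, add_zero, ← Finset.sum_filter]
  simp only [Finset.sum_const, nsmul_eq_mul, mul_one, edgeCount]
  rw [Nat.card_eq_fintype_card, ← SimpleGraph.edgeFinset_card]
  congr 3
  ext e
  simp only [offDiagPairs, Finset.mem_filter, SimpleGraph.mem_edgeFinset, Finset.mem_univ,
    true_and]
  exact ⟨fun h => h.2, fun h => ⟨G.not_isDiag_of_mem_edgeSet h, h⟩⟩

lemma card_orderings_of_three {α : Type*} [Fintype α] [DecidableEq α] {a b c : α} (hab : a ≠ b) (hac : a ≠ c)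
    (hbc : b ≠ c) :
    (Finset.univ.filter fun q : α × α × α =>
      (q.1 ≠ q.2.1 ∧ q.2.1 ≠ q.2.2 ∧ q.2.2 ≠ q.1) ∧
        ({q.1, q.2.1, q.2.2} : Finset α) = {a, b, c}).card = 6 := by
  have : (Finset.univ.filter fun q : α × α × α =>
      (q.1 ≠ q.2.1 ∧ q.2.1 ≠ q.2.2 ∧ q.2.2 ≠ q.1) ∧
        ({q.1, q.2.1, q.2.2} : Finset α) = {a, b, c})
      = {(a, b, c), (a, c, b), (b, a, c), (b, c, a), (c, a, b), (c, b, a)} := by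
    ext ⟨x, y, z⟩
    simp only [Finset.mem_filter, Finset.mem_univ, true_and, Finset.mem_insert,
      Finset.mem_singleton, Prod.mk.injEq]
    constructor
    · rintro ⟨⟨hxy, hyz, hzx⟩, h⟩
      have hx : x ∈ ({a, b, c} : Finset α) := by rw [← h]; simp
      have hy : y ∈ ({a, b, c} : Finset α) := by rw [← h]; simp
      have hz : z ∈ ({a, b, c} : Finset α) := by rw [← h]; simp
      simp only [Finset.mem_insert, Finset.mem_singleton] at hx hy hz
      grind
    · intro h
      refine ⟨by grind, ?_⟩
      ext w
      simp only [Finset.mem_insert, Finset.mem_singleton]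
      grind
  rw [this]
  simp [Finset.card_insert_of_notMem, hab, hac, hbc, hab.symm, hac.symm, hbc.symm]

lemma sum_adjReal_triangle {n : ℕ} (G : SimpleGraph (Fin n)) :
    ∑ i, ∑ j, ∑ k, adjReal G i j * adjReal G j k * adjReal G k i = 6 * (triCount G : ℝ) := by
  set P : Finset (Fin n × Fin n × Fin n) :=
    Finset.univ.filter fun q => G.Adj q.1 q.2.1 ∧ G.Adj q.2.1 q.2.2 ∧ G.Adj q.2.2 q.1 with hP
  have h1 : ∑ i, ∑ j, ∑ k, adjReal G i j * adjReal G j k * adjReal G k i = (P.card : ℝ) := by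
    rw [hP, Finset.card_filter]
    push_cast
    rw [Fintype.sum_prod_type]
    refine Finset.sum_congr rfl fun i _ => ?_
    rw [Fintype.sum_prod_type]
    refine Finset.sum_congr rfl fun j _ => Finset.sum_congr rfl fun k _ => ?_
    simp only [adjReal]
    split_ifs <;> simp_all
  have hmaps : Set.MapsTo (fun q : Fin n × Fin n × Fin n => ({q.1, q.2.1, q.2.2} : Finset (Fin n)))
      (P : Set (Fin n × Fin n × Fin n))
      ((Finset.univ.filter fun s => G.IsNClique 3 s : Finset (Finset (Fin n))) :
        Set (Finset (Fin n))) := by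
    intro q hq
    have hq' : G.Adj q.1 q.2.1 ∧ G.Adj q.2.1 q.2.2 ∧ G.Adj q.2.2 q.1 := by
      simpa [hP] using hq
    simp only [Finset.coe_filter, Finset.mem_univ, true_and, Set.mem_ofPred_eq]
    exact SimpleGraph.is3Clique_triple_iff.2 ⟨hq'.1, hq'.2.2.symm, hq'.2.1⟩
  have h2 : P.card = triCount G * 6 := by
    rw [Finset.card_eq_sum_card_fiberwise hmaps, triCount, Nat.card_eq_fintype_card,
      Fintype.card_subtype]
    refine Finset.sum_const_nat fun s hs => ?_
    obtain ⟨a, b, c, hab, hac, hbc, rfl⟩ :=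
      SimpleGraph.is3Clique_iff.1 (Finset.mem_filter.1 hs).2
    rw [← card_orderings_of_three hab.ne hac.ne hbc.ne]
    congr 1
    ext ⟨x, y, z⟩
    simp only [hP, Finset.mem_filter, Finset.mem_univ, true_and]
    refine and_congr_left fun h => ?_
    constructor
    · rintro ⟨h1, h2, h3⟩
      exact ⟨h1.ne, h2.ne, h3.ne⟩
    · rintro ⟨h1, h2, h3⟩
      have h4 : G.IsNClique 3 {x, y, z} := by
        rw [h]
        exact SimpleGraph.is3Clique_triple_iff.2 ⟨hab, hac, hbc⟩
      obtain ⟨h5, h6, h7⟩ := SimpleGraph.is3Clique_triple_iff.1 h4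
      exact ⟨h5, h7, h6.symm⟩
  rw [h1, h2]
  push_cast
  ring

/-- `CutBound M δ` says that the (unnormalized) cut norm of the square matrix `M` is at most `δ`. -/
def CutBound {n : ℕ} (M : Fin n → Fin n → ℝ) (δ : ℝ) : Prop :=
  ∀ S T : Finset (Fin n), |∑ i ∈ S, ∑ j ∈ T, M i j| ≤ δ

lemma sum_mul_le_sum_filter_pos {ι : Type*} [Fintype ι] {u : ι → ℝ} (c : ι → ℝ)
    (hu : ∀ i, u i ∈ Set.Icc (0 : ℝ) 1) :
    ∑ i, u i * c i ≤ ∑ i ∈ Finset.univ.filter (fun i => 0 < c i), c i := by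
  rw [Finset.sum_filter]
  refine Finset.sum_le_sum fun i _ => ?_
  split_ifs with h
  · nlinarith [(hu i).2]
  · nlinarith [(hu i).1]

namespace CutBound

variable {n : ℕ} {M N : Fin n → Fin n → ℝ} {δ δ' : ℝ}

lemma neg (h : CutBound M δ) : CutBound (fun i j => -M i j) δ := by
  intro S T
  simpa [Finset.sum_neg_distrib] using h S T

lemma add (h : CutBound M δ) (h' : CutBound N δ') :
    CutBound (fun i j => M i j + N i j) (δ + δ') := by
  intro S T
  simp_rw [Finset.sum_add_distrib]
  exact (abs_add_le _ _).trans (add_le_add (h S T) (h' S T))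

lemma of_sum_abs_le (h : ∑ i, ∑ j, |M i j| ≤ δ) : CutBound M δ := by
  intro S T
  refine le_trans ?_ h
  refine (Finset.abs_sum_le_sum_abs _ _).trans ?_
  refine (Finset.sum_le_sum fun i _ => Finset.abs_sum_le_sum_abs _ _).trans ?_
  refine (Finset.sum_le_sum fun i _ => Finset.sum_le_sum_of_subset_of_nonneg
    (Finset.subset_univ T) fun j _ _ => abs_nonneg _).trans ?_
  exact Finset.sum_le_sum_of_subset_of_nonneg (Finset.subset_univ S)
    fun i _ _ => Finset.sum_nonneg fun j _ => abs_nonneg _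

lemma sum_mul_mul_le (h : CutBound M δ) {u v : Fin n → ℝ} (hu : ∀ i, u i ∈ Set.Icc (0 : ℝ) 1)
    (hv : ∀ i, v i ∈ Set.Icc (0 : ℝ) 1) : ∑ i, ∑ j, M i j * u i * v j ≤ δ := by
  have h1 : ∑ i, ∑ j, M i j * u i * v j = ∑ i, u i * ∑ j, M i j * v j := by
    refine Finset.sum_congr rfl fun i _ => ?_
    rw [Finset.mul_sum]
    exact Finset.sum_congr rfl fun j _ => by ring
  rw [h1]
  refine (sum_mul_le_sum_filter_pos (fun i => ∑ j, M i j * v j) hu).trans ?_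
  rw [Finset.sum_comm]
  simp_rw [← Finset.sum_mul, mul_comm _ (v _)]
  refine (sum_mul_le_sum_filter_pos _ hv).trans ?_
  rw [Finset.sum_comm]
  exact (le_abs_self _).trans (h _ _)

lemma abs_sum_mul_mul_le (h : CutBound M δ) {u v : Fin n → ℝ}
    (hu : ∀ i, u i ∈ Set.Icc (0 : ℝ) 1) (hv : ∀ i, v i ∈ Set.Icc (0 : ℝ) 1) :
    |∑ i, ∑ j, M i j * u i * v j| ≤ δ := by
  refine abs_le.2 ⟨?_, h.sum_mul_mul_le hu hv⟩
  have := h.neg.sum_mul_mul_le hu hv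
  simp only [neg_mul, Finset.sum_neg_distrib] at this
  linarith

end CutBound

/-- Cut-close symmetric matrices with entries in `[0, 1]` have close triangle sums. -/
lemma triangle_sum_le_of_cutBound {n : ℕ} {x p : Fin n → Fin n → ℝ} {δ : ℝ}
    (hx : ∀ i j, x i j ∈ Set.Icc (0 : ℝ) 1) (hp : ∀ i j, p i j ∈ Set.Icc (0 : ℝ) 1)
    (h : CutBound (fun i j => x i j - p i j) δ) :
    ∑ i, ∑ j, ∑ k, x i j * x j k * x k i ≤
      ∑ i, ∑ j, ∑ k, p i j * p j k * p k i + 3 * n * δ := by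
  have h1 : ∑ i, ∑ j, ∑ k, (x i j - p i j) * x k i * x j k ≤ n * δ := by
    have : ∑ i, ∑ j, ∑ k, (x i j - p i j) * x k i * x j k
        = ∑ k, ∑ i, ∑ j, (x i j - p i j) * x k i * x j k := by
      rw [Finset.sum_congr rfl fun i _ => Finset.sum_comm, Finset.sum_comm]
    rw [this]
    calc _ ≤ ∑ _k : Fin n, δ := Finset.sum_le_sum fun k _ =>
          h.sum_mul_mul_le (fun i => hx k i) (fun j => hx j k)
      _ = n * δ := by simp
  have h2 : ∑ i, ∑ j, ∑ k, (x j k - p j k) * p i j * x k i ≤ n * δ := by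
    calc _ ≤ ∑ _k : Fin n, δ := Finset.sum_le_sum fun i _ =>
          h.sum_mul_mul_le (fun j => hp i j) (fun k => hx k i)
      _ = n * δ := by simp
  have h3 : ∑ i, ∑ j, ∑ k, (x k i - p k i) * p j k * p i j ≤ n * δ := by
    have : ∑ i, ∑ j, ∑ k, (x k i - p k i) * p j k * p i j
        = ∑ j, ∑ k, ∑ i, (x k i - p k i) * p j k * p i j := by
      rw [Finset.sum_comm]
      exact Finset.sum_congr rfl fun j _ => Finset.sum_comm
    rw [this]
    calc _ ≤ ∑ _k : Fin n, δ := Finset.sum_le_sum fun j _ =>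
          h.sum_mul_mul_le (fun k => hp j k) (fun i => hp i j)
      _ = n * δ := by simp
  have h4 : ∑ i, ∑ j, ∑ k, x i j * x j k * x k i = ∑ i, ∑ j, ∑ k, p i j * p j k * p k i
      + (∑ i, ∑ j, ∑ k, (x i j - p i j) * x k i * x j k
        + ∑ i, ∑ j, ∑ k, (x j k - p j k) * p i j * x k i
        + ∑ i, ∑ j, ∑ k, (x k i - p k i) * p j k * p i j) := by
    simp_rw [← Finset.sum_add_distrib]
    refine Finset.sum_congr rfl fun i _ => Finset.sum_congr rfl fun j _ =>
      Finset.sum_congr rfl fun k _ => ?_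
    ring
  linarith

/-- Matrices obtained from `0` by adding `k` rectangles with coefficients in `{-ε, 0, ε}`. -/
noncomputable def cutNet (n : ℕ) (ε : ℝ) : ℕ → Finset (Fin n → Fin n → ℝ)
  | 0 => {0}
  | k + 1 => (cutNet n ε k ×ˢ (({-ε, 0, ε} : Finset ℝ) ×ˢ
      (Finset.univ : Finset (Finset (Fin n) × Finset (Fin n))))).image fun q =>
        fun i j => q.1 i j + q.2.1 * (if i ∈ q.2.2.1 ∧ j ∈ q.2.2.2 then 1 else 0)

lemma card_cutNet_le (n : ℕ) (ε : ℝ) (k : ℕ) : (cutNet n ε k).card ≤ (3 * 4 ^ n) ^ k := by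
  induction k with
  | zero => simp [cutNet]
  | succ k ih =>
    rw [cutNet]
    refine Finset.card_image_le.trans ?_
    rw [Finset.card_product, Finset.card_product, pow_succ]
    have h3 : ({-ε, 0, ε} : Finset ℝ).card ≤ 3 := Finset.card_le_three
    have h4 : (Finset.univ : Finset (Finset (Fin n) × Finset (Fin n))).card = 4 ^ n := by
      simp [Finset.card_univ, ← mul_pow]
    rw [h4]
    gcongr

/-- Weak regularity: every matrix of squared Frobenius norm at most `n ^ 2` is cut-close to an
element of the net, by the energy decrement argument. -/
lemma exists_mem_cutNet_or {n : ℕ} {ε : ℝ} (hε : 0 < ε) (a : Fin n → Fin n → ℝ)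
    (ha : ∑ i, ∑ j, a i j ^ 2 ≤ (n : ℝ) ^ 2) (k : ℕ) :
    ∃ W ∈ cutNet n ε k, CutBound (fun i j => a i j - W i j) (ε * n ^ 2) ∨
      ∑ i, ∑ j, (a i j - W i j) ^ 2 ≤ (n : ℝ) ^ 2 - k * (ε ^ 2 * n ^ 2) := by
  induction k with
  | zero => exact ⟨0, by simp [cutNet], Or.inr (by simpa using ha)⟩
  | succ k ih =>
    obtain ⟨W, hW, h⟩ := ih
    by_cases hc : CutBound (fun i j => a i j - W i j) (ε * n ^ 2)
    · refine ⟨W, ?_, Or.inl hc⟩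
      rw [cutNet, Finset.mem_image]
      exact ⟨(W, 0, ∅, ∅), by simp [hW], by simp⟩
    · have h' := h.resolve_left hc
      simp only [CutBound, not_forall, not_le] at hc
      obtain ⟨S, T, hST⟩ := hc
      set s := ∑ i ∈ S, ∑ j ∈ T, (a i j - W i j) with hs
      obtain ⟨c, hc, hcs, hc2⟩ : ∃ c ∈ ({-ε, 0, ε} : Finset ℝ), c * s = ε * |s| ∧ c ^ 2 = ε ^ 2 := by
        rcases abs_cases s with h | h
        · exact ⟨ε, by simp, by rw [h.1], rfl⟩
        · exact ⟨-ε, by simp, by rw [h.1]; ring, by ring⟩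
      refine ⟨fun i j => W i j + c * (if i ∈ S ∧ j ∈ T then 1 else 0), ?_, Or.inr ?_⟩
      · rw [cutNet, Finset.mem_image]
        exact ⟨(W, c, S, T), by simp only [Finset.mem_product]; exact ⟨hW, hc, Finset.mem_univ _⟩,
          rfl⟩
      · have hrect : ∀ f : Fin n → Fin n → ℝ,
            ∑ i, ∑ j, f i j * (if i ∈ S ∧ j ∈ T then 1 else 0) = ∑ i ∈ S, ∑ j ∈ T, f i j := by
          intro f
          rw [← Finset.sum_filter_add_sum_filter_not Finset.univ (fun i => i ∈ S)]
          have : ∑ i ∈ Finset.univ.filter (fun i => ¬ i ∈ S),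
              ∑ j, f i j * (if i ∈ S ∧ j ∈ T then 1 else 0) = 0 := by
            refine Finset.sum_eq_zero fun i hi => ?_
            simp [(Finset.mem_filter.1 hi).2]
          rw [this, add_zero, Finset.filter_mem_eq_inter, Finset.univ_inter]
          refine Finset.sum_congr rfl fun i hi => ?_
          simp [hi]
        have hexp : ∑ i, ∑ j, (a i j - (W i j + c * (if i ∈ S ∧ j ∈ T then 1 else 0))) ^ 2
            = ∑ i, ∑ j, (a i j - W i j) ^ 2 - 2 * c * s
              + c ^ 2 * ∑ i ∈ S, ∑ j ∈ T, (1 : ℝ) := by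
          rw [hs, ← hrect, ← hrect]
          simp_rw [Finset.mul_sum, ← Finset.sum_sub_distrib, ← Finset.sum_add_distrib]
          refine Finset.sum_congr rfl fun i _ => Finset.sum_congr rfl fun j _ => ?_
          split_ifs <;> ring
        have hcard : ∑ i ∈ S, ∑ j ∈ T, (1 : ℝ) ≤ (n : ℝ) ^ 2 := by
          simp only [Finset.sum_const, nsmul_eq_mul, mul_one]
          have hS : (S.card : ℝ) ≤ n := by exact_mod_cast card_finset_fin_le S
          have hT : (T.card : ℝ) ≤ n := by exact_mod_cast card_finset_fin_le T
          nlinarith [(Nat.cast_nonneg T.card : (0 : ℝ) ≤ T.card)]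
        rw [hexp, hc2]
        push_cast
        have h5 : ε ^ 2 * ∑ i ∈ S, ∑ j ∈ T, (1 : ℝ) ≤ ε ^ 2 * n ^ 2 := by gcongr
        have h6 : ε * (ε * n ^ 2) ≤ ε * |s| := by gcongr
        linarith

lemma exists_mem_cutNet {n : ℕ} {ε : ℝ} (hε : 0 < ε) (a : Fin n → Fin n → ℝ)
    (ha : ∑ i, ∑ j, a i j ^ 2 ≤ (n : ℝ) ^ 2) {k : ℕ} (hk : 1 < k * ε ^ 2) :
    ∃ W ∈ cutNet n ε k, CutBound (fun i j => a i j - W i j) (ε * n ^ 2) := by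
  rcases Nat.eq_zero_or_pos n with rfl | hn
  · obtain ⟨W, hW, -⟩ := exists_mem_cutNet_or hε a ha k
    exact ⟨W, hW, fun S T => by simp [Finset.eq_empty_of_isEmpty S]⟩
  · obtain ⟨W, hW, h | h⟩ := exists_mem_cutNet_or hε a ha k
    · exact ⟨W, hW, h⟩
    · exfalso
      have h0 : 0 ≤ ∑ i, ∑ j, (a i j - W i j) ^ 2 :=
        Finset.sum_nonneg fun i _ => Finset.sum_nonneg fun j _ => sq_nonneg _
      have hn' : (0 : ℝ) < (n : ℝ) ^ 2 := by positivity
      nlinarith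

lemma gibbsWeight_eq {n : ℕ} (α h : ℝ) (G : SimpleGraph (Fin n)) :
    gibbsWeight α h G = Real.exp (α / (6 * n) *
      (∑ i, ∑ j, ∑ k, adjReal G i j * adjReal G j k * adjReal G k i) +
        h / 2 * ∑ i, ∑ j, adjReal G i j) := by
  rw [gibbsWeight, sum_sum_adjReal, sum_adjReal_triangle]
  congr 1
  rcases Nat.eq_zero_or_pos n with rfl | hn
  · simp; ring
  · field_simp

lemma gibbsWeight_pos {n : ℕ} (α h : ℝ) (G : SimpleGraph (Fin n)) : 0 < gibbsWeight α h G :=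
  Real.exp_pos _

lemma adjReal_mem_Icc {n : ℕ} (G : SimpleGraph (Fin n)) (i j : Fin n) :
    adjReal G i j ∈ Set.Icc (0 : ℝ) 1 := by
  unfold adjReal
  split_ifs <;> simp

lemma sum_mul_log_le {ι : Type*} {B : Finset ι} {μ ν : ι → ℝ} (hμ : ∀ x ∈ B, 0 < μ x)
    (hν : ∀ x ∈ B, 0 < ν x) (hμ1 : ∑ x ∈ B, μ x = 1) (hν1 : ∑ x ∈ B, ν x ≤ 1) :
    ∑ x ∈ B, μ x * Real.log (ν x) ≤ ∑ x ∈ B, μ x * Real.log (μ x) := by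
  have : ∀ x ∈ B, μ x * Real.log (ν x) ≤ μ x * Real.log (μ x) + (ν x - μ x) := by
    intro x hx
    have h1 := Real.log_le_sub_one_of_pos (div_pos (hν x hx) (hμ x hx))
    rw [Real.log_div (hν x hx).ne' (hμ x hx).ne'] at h1
    have h2 := mul_le_mul_of_nonneg_left h1 (hμ x hx).le
    have h3 : μ x * (ν x / μ x - 1) = ν x - μ x := by
      have := (hμ x hx).ne'
      field_simp
    linarith
  have := Finset.sum_le_sum this
  rw [Finset.sum_add_distrib, Finset.sum_sub_distrib] at this
  linarith

/-- The likelihood of `G` under independent edges with edge probabilities `p`. -/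
noncomputable def productWeight {n : ℕ} (p : Sym2 (Fin n) → ℝ) (G : SimpleGraph (Fin n)) : ℝ :=
  ∏ e ∈ offDiagPairs n, (if e ∈ G.edgeSet then p e else 1 - p e)

lemma sum_productWeight {n : ℕ} (p : Sym2 (Fin n) → ℝ) : ∑ G, productWeight p G = 1 := by
  simp_rw [productWeight]
  rw [sum_graph_prod_ite p fun e => 1 - p e]
  simp

lemma log_productWeight {n : ℕ} {p : Sym2 (Fin n) → ℝ} {G : SimpleGraph (Fin n)}
    (hpos : ∀ e ∈ offDiagPairs n, 0 < if e ∈ G.edgeSet then p e else 1 - p e) :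
    Real.log (productWeight p G) = ∑ e ∈ offDiagPairs n,
      ((if e ∈ G.edgeSet then (1 : ℝ) else 0) * Real.log (p e) +
        (1 - if e ∈ G.edgeSet then (1 : ℝ) else 0) * Real.log (1 - p e)) := by
  rw [productWeight, Real.log_prod fun e he => (hpos e he).ne']
  refine Finset.sum_congr rfl fun e _ => ?_
  split_ifs <;> simp

lemma triangle_sum_eq_cubes_sub {n : ℕ} (p : Fin n → Fin n → ℝ) :
    ∑ i, ∑ j, ∑ k, p i j * p j k * p k i = n * ∑ i, ∑ j, p i j ^ 3 -
      (∑ i, ∑ j, ∑ k, (p i j ^ 3 + p j k ^ 3 + p k i ^ 3 - 3 * (p i j * p j k * p k i))) / 3 := by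
  have h1 : ∑ i, ∑ j, ∑ _k : Fin n, p i j ^ 3 = n * ∑ i, ∑ j, p i j ^ 3 := by
    simp [Finset.mul_sum]
  have h2 : ∑ _i : Fin n, ∑ j, ∑ k, p j k ^ 3 = n * ∑ i, ∑ j, p i j ^ 3 := by
    simp
  have h3 : ∑ i, ∑ _j : Fin n, ∑ k, p k i ^ 3 = n * ∑ i, ∑ j, p i j ^ 3 := by
    simp only [Finset.sum_const, Finset.card_univ, Fintype.card_fin, nsmul_eq_mul]
    rw [← Finset.mul_sum, Finset.sum_comm]
  simp_rw [Finset.sum_sub_distrib, Finset.sum_add_distrib, ← Finset.mul_sum]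
  rw [h1, h2, h3]
  ring

/-- Gibbs variational bound on the weight of a class of graphs which are all cut-close to a
common matrix `W`, in terms of the mean adjacency matrix `p` of the conditioned measure. -/
lemma sum_gibbsWeight_le_of_cutBound {n : ℕ} (hn : 0 < n) {α : ℝ} (hα : 0 < α) (h : ℝ)
    {B : Finset (SimpleGraph (Fin n))} (hB : B.Nonempty) {W : Fin n → Fin n → ℝ} {δ : ℝ}
    (hW : ∀ G ∈ B, CutBound (fun i j => adjReal G i j - W i j) δ) :
    ∃ p : Fin n → Fin n → ℝ, (∀ i j, p i j ∈ Set.Icc (0 : ℝ) 1) ∧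
      CutBound (fun i j => p i j - W i j) δ ∧
      ∑ G ∈ B, gibbsWeight α h G ≤ Real.exp (∑ i, ∑ j, gFun α h (p i j) - α / (18 * n) *
        (∑ i, ∑ j, ∑ k, (p i j ^ 3 + p j k ^ 3 + p k i ^ 3 - 3 * (p i j * p j k * p k i)))
          + α * δ) := by
  set Z := ∑ G ∈ B, gibbsWeight α h G with hZ
  have hZpos : 0 < Z := Finset.sum_pos (fun G _ => gibbsWeight_pos α h G) hB
  set μ : SimpleGraph (Fin n) → ℝ := fun G => gibbsWeight α h G / Z with hμ
  have hμpos : ∀ G, 0 < μ G := fun G => div_pos (gibbsWeight_pos α h G) hZpos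
  have hμ1 : ∑ G ∈ B, μ G = 1 := by
    rw [hμ, ← Finset.sum_div]
    exact div_self hZpos.ne'
  set P : Sym2 (Fin n) → ℝ := fun e => ∑ G ∈ B, μ G * (if e ∈ G.edgeSet then 1 else 0) with hP
  set p : Fin n → Fin n → ℝ := fun i j => P s(i, j) with hp
  have hpadj : ∀ i j, p i j = ∑ G ∈ B, μ G * adjReal G i j := by
    intro i j
    simp_rw [adjReal_eq_indicator]
    rfl
  have hP0 : ∀ e, 0 ≤ P e := fun e => Finset.sum_nonneg fun G _ =>
    mul_nonneg (hμpos G).le (by split_ifs <;> simp)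
  have hP' : ∀ e, 1 - P e = ∑ G ∈ B, μ G * (1 - if e ∈ G.edgeSet then 1 else 0) := by
    intro e
    simp_rw [mul_sub, Finset.sum_sub_distrib, mul_one]
    rw [hμ1]
  have hP1 : ∀ e, P e ≤ 1 := by
    intro e
    have : 0 ≤ 1 - P e := by
      rw [hP']
      exact Finset.sum_nonneg fun G _ => mul_nonneg (hμpos G).le (by split_ifs <;> simp)
    linarith
  have hp01 : ∀ i j, p i j ∈ Set.Icc (0 : ℝ) 1 := fun i j => ⟨hP0 _, hP1 _⟩
  have hpW : CutBound (fun i j => p i j - W i j) δ := by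
    intro S T
    have h1 : ∑ i ∈ S, ∑ j ∈ T, (p i j - W i j)
        = ∑ G ∈ B, μ G * ∑ i ∈ S, ∑ j ∈ T, (adjReal G i j - W i j) := by
      simp_rw [Finset.mul_sum]
      rw [Finset.sum_comm (s := B)]
      refine Finset.sum_congr rfl fun i _ => ?_
      rw [Finset.sum_comm (s := B)]
      refine Finset.sum_congr rfl fun j _ => ?_
      simp_rw [mul_sub, Finset.sum_sub_distrib]
      rw [hpadj, ← Finset.sum_mul, hμ1, one_mul]
    rw [h1]
    refine (Finset.abs_sum_le_sum_abs _ _).trans ?_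
    calc ∑ G ∈ B, |μ G * ∑ i ∈ S, ∑ j ∈ T, (adjReal G i j - W i j)|
        ≤ ∑ G ∈ B, μ G * δ := by
          refine Finset.sum_le_sum fun G hG => ?_
          rw [abs_mul, abs_of_pos (hμpos G)]
          exact mul_le_mul_of_nonneg_left (hW G hG S T) (hμpos G).le
      _ = δ := by rw [← Finset.sum_mul, hμ1, one_mul]
  refine ⟨p, hp01, hpW, ?_⟩
  -- positivity of the product measure with the same marginals
  have hfac : ∀ G ∈ B, ∀ e ∈ offDiagPairs n, 0 < if e ∈ G.edgeSet then P e else 1 - P e := by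
    intro G hG e _
    split_ifs with he
    · refine (hμpos G).trans_le ?_
      have := Finset.single_le_sum (f := fun G => μ G * (if e ∈ G.edgeSet then (1 : ℝ) else 0))
        (fun G _ => mul_nonneg (hμpos G).le (by split_ifs <;> simp)) hG
      simpa only [if_pos he, mul_one] using this
    · refine (hμpos G).trans_le ?_
      rw [hP']
      have := Finset.single_le_sum
        (f := fun G => μ G * (1 - if e ∈ G.edgeSet then (1 : ℝ) else 0))
        (fun G _ => mul_nonneg (hμpos G).le (by split_ifs <;> simp)) hG
      simpa [he] using this
  have hνpos : ∀ G ∈ B, 0 < productWeight P G := fun G hG => Finset.prod_pos (hfac G hG)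
  have hν1 : ∑ G ∈ B, productWeight P G ≤ 1 := by
    rw [← sum_productWeight P]
    refine Finset.sum_le_sum_of_subset_of_nonneg (Finset.subset_univ _) fun G _ _ => ?_
    refine Finset.prod_nonneg fun e _ => ?_
    split_ifs
    · exact hP0 e
    · linarith [hP1 e]
  have hgibbs := sum_mul_log_le (fun G _ => hμpos G) hνpos hμ1 hν1
  have hent : ∑ G ∈ B, μ G * Real.log (productWeight P G)
      = ∑ e ∈ offDiagPairs n, (P e * Real.log (P e) + (1 - P e) * Real.log (1 - P e)) := by
    calc _ = ∑ G ∈ B, ∑ e ∈ offDiagPairs n,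
          (μ G * (if e ∈ G.edgeSet then (1 : ℝ) else 0) * Real.log (P e) +
            μ G * (1 - if e ∈ G.edgeSet then (1 : ℝ) else 0) * Real.log (1 - P e)) := by
          refine Finset.sum_congr rfl fun G hG => ?_
          rw [log_productWeight (hfac G hG), Finset.mul_sum]
          exact Finset.sum_congr rfl fun e _ => by ring
      _ = _ := by
          rw [Finset.sum_comm]
          refine Finset.sum_congr rfl fun e _ => ?_
          rw [Finset.sum_add_distrib, ← Finset.sum_mul, ← Finset.sum_mul, ← hP']
  have hent2 : ∑ e ∈ offDiagPairs n, (P e * Real.log (P e) + (1 - P e) * Real.log (1 - P e))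
      = (∑ i, ∑ j, (p i j * Real.log (p i j) + (1 - p i j) * Real.log (1 - p i j))) / 2 := by
    have := sum_sum_sym2_mk fun e => P e * Real.log (P e) + (1 - P e) * Real.log (1 - P e)
    have hd : ∀ i, P s(i, i) = 0 := by
      intro i
      simp [hP]
    simp only [hd, zero_mul, sub_zero, Real.log_one, mul_zero, add_zero,
      Finset.sum_const_zero] at this
    simp only [hp]
    linarith
  -- the energy of a typical graph of the class
  have htri : ∀ G ∈ B, ∑ i, ∑ j, ∑ k, adjReal G i j * adjReal G j k * adjReal G k i ≤
      ∑ i, ∑ j, ∑ k, p i j * p j k * p k i + 3 * n * (δ + δ) := by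
    intro G hG
    refine triangle_sum_le_of_cutBound (adjReal_mem_Icc G) hp01 ?_
    have := (hW G hG).add hpW.neg
    simpa using this
  have hlogμ : ∀ G, Real.log (μ G) = α / (6 * n) *
      (∑ i, ∑ j, ∑ k, adjReal G i j * adjReal G j k * adjReal G k i) +
        h / 2 * ∑ i, ∑ j, adjReal G i j - Real.log Z := by
    intro G
    rw [hμ]
    simp only
    rw [Real.log_div (gibbsWeight_pos α h G).ne' hZpos.ne', gibbsWeight_eq, Real.log_exp]
  have hedge : ∑ G ∈ B, μ G * ∑ i, ∑ j, adjReal G i j = ∑ i, ∑ j, p i j := by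
    simp_rw [Finset.mul_sum]
    rw [Finset.sum_comm]
    refine Finset.sum_congr rfl fun i _ => ?_
    rw [Finset.sum_comm]
    exact Finset.sum_congr rfl fun j _ => (hpadj i j).symm
  have hn' : (0 : ℝ) < n := by exact_mod_cast hn
  have hup : ∑ G ∈ B, μ G * Real.log (μ G) ≤ α / (6 * n) *
      (∑ i, ∑ j, ∑ k, p i j * p j k * p k i + 3 * n * (δ + δ)) +
        h / 2 * ∑ i, ∑ j, p i j - Real.log Z := by
    calc _ ≤ ∑ G ∈ B, (μ G * (α / (6 * n) *
          (∑ i, ∑ j, ∑ k, p i j * p j k * p k i + 3 * n * (δ + δ)) - Real.log Z) +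
            h / 2 * (μ G * ∑ i, ∑ j, adjReal G i j)) := by
          refine Finset.sum_le_sum fun G hG => ?_
          rw [hlogμ]
          have h1 := mul_le_mul_of_nonneg_left (htri G hG)
            (show 0 ≤ μ G * (α / (6 * n)) from mul_nonneg (hμpos G).le (by positivity))
          nlinarith
      _ = _ := by
          rw [Finset.sum_add_distrib, ← Finset.sum_mul, hμ1, ← Finset.mul_sum, hedge]
          ring
  rw [hent, hent2] at hgibbs
  rw [triangle_sum_eq_cubes_sub] at hup
  rw [← Real.log_le_iff_le_exp hZpos]
  have hg : ∑ i, ∑ j, gFun α h (p i j) = α / 6 * ∑ i, ∑ j, p i j ^ 3 + h / 2 * ∑ i, ∑ j, p i j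
      - (∑ i, ∑ j, (p i j * Real.log (p i j) + (1 - p i j) * Real.log (1 - p i j))) / 2 := by
    simp_rw [gFun, Finset.sum_sub_distrib, Finset.sum_add_distrib, ← Finset.mul_sum,
      ← Finset.sum_div]
    simp_rw [Finset.sum_add_distrib]
  rw [hg]
  generalize ∑ i, ∑ j, ∑ k, (p i j ^ 3 + p j k ^ 3 + p k i ^ 3 - 3 * (p i j * p j k * p k i)) = D
    at *
  generalize ∑ i, ∑ j, p i j ^ 3 = Q at *
  have e1 : α / (6 * n) * (n * Q - D / 3 + 3 * n * (δ + δ))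
      = α / 6 * Q - α / (18 * n) * D + α * δ := by
    field_simp
    ring
  rw [e1] at hup
  linarith

lemma sum_productWeight_const_of_subset {n : ℕ} (u : ℝ) {F : Finset (Sym2 (Fin n))}
    (hF : F ⊆ offDiagPairs n) :
    ∑ G : SimpleGraph (Fin n), productWeight (fun _ => u) G *
      (if ∀ e ∈ F, e ∈ G.edgeSet then 1 else 0) = u ^ F.card := by
  have h1 : ∀ G : SimpleGraph (Fin n), productWeight (fun _ => u) G *
      (if ∀ e ∈ F, e ∈ G.edgeSet then 1 else 0)
      = ∏ e ∈ offDiagPairs n, (if e ∈ G.edgeSet then u else if e ∈ F then 0 else 1 - u) := by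
    intro G
    split_ifs with hG
    · rw [mul_one, productWeight]
      refine Finset.prod_congr rfl fun e _ => ?_
      split_ifs with h1 h2
      · rfl
      · exact absurd (hG e h2) h1
      · rfl
    · push Not at hG
      obtain ⟨e, he, heG⟩ := hG
      rw [mul_zero, eq_comm]
      exact Finset.prod_eq_zero (hF he) (by simp [he, heG])
  simp_rw [h1]
  rw [sum_graph_prod_ite (fun _ => u) fun e => if e ∈ F then 0 else 1 - u]
  calc _ = ∏ e ∈ offDiagPairs n, (if e ∈ F then u else 1) := by
        refine Finset.prod_congr rfl fun e _ => ?_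
        split_ifs <;> ring
    _ = u ^ F.card := by
        rw [Finset.prod_ite, Finset.prod_const_one, mul_one, Finset.prod_const]
        congr 2
        rw [Finset.filter_mem_eq_inter, Finset.inter_eq_right.2 hF]

/-- Lower bound on the partition function from the Erdős–Rényi trial measure. -/
lemma exp_le_sum_gibbsWeight {n : ℕ} (hn : 0 < n) {α : ℝ} (hα : 0 < α) (h : ℝ) {u : ℝ}
    (hu0 : 0 < u) (hu1 : u < 1) :
    Real.exp (n ^ 2 * gFun α h u - n * (α / 2 * u ^ 3 + h / 2 * u
      - (u * Real.log u + (1 - u) * Real.log (1 - u)) / 2)) ≤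
      ∑ G : SimpleGraph (Fin n), gibbsWeight α h G := by
  set ν : SimpleGraph (Fin n) → ℝ := productWeight (fun _ => u) with hν
  have hfac : ∀ G : SimpleGraph (Fin n), ∀ e ∈ offDiagPairs n,
      0 < if e ∈ G.edgeSet then u else 1 - u := by
    intro G e _
    split_ifs <;> linarith
  have hνpos : ∀ G, 0 < ν G := fun G => Finset.prod_pos (hfac G)
  have hν1 : ∑ G, ν G = 1 := sum_productWeight _
  have hn' : (0 : ℝ) < n := by exact_mod_cast hn
  have hcard : ((offDiagPairs n).card : ℝ) = (n ^ 2 - n) / 2 := by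
    have := sum_sum_sym2_mk (n := n) fun _ => (1 : ℝ)
    simp only [Finset.sum_const, Finset.card_univ, Fintype.card_fin, nsmul_eq_mul, mul_one] at this
    linarith
  have hone : ∀ e ∈ offDiagPairs n, ∑ G, ν G * (if e ∈ G.edgeSet then 1 else 0) = u := by
    intro e he
    have := sum_productWeight_const_of_subset u (F := {e}) (by simpa using he)
    simpa using this
  have hedge : ∑ G, ν G * ∑ i, ∑ j, adjReal G i j = (n ^ 2 - n) * u := by
    have h1 : ∀ G : SimpleGraph (Fin n), ∑ i, ∑ j, adjReal G i j
        = 2 * ∑ e ∈ offDiagPairs n, if e ∈ G.edgeSet then 1 else 0 := by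
      intro G
      simp_rw [adjReal_eq_indicator]
      rw [sum_sum_sym2_mk fun e => if e ∈ G.edgeSet then (1 : ℝ) else 0]
      simp
    simp_rw [h1, Finset.mul_sum]
    rw [Finset.sum_comm]
    calc _ = ∑ e ∈ offDiagPairs n, 2 * u := by
          refine Finset.sum_congr rfl fun e he => ?_
          rw [← hone e he, Finset.mul_sum]
          exact Finset.sum_congr rfl fun G _ => by ring
      _ = _ := by
          rw [Finset.sum_const, nsmul_eq_mul, hcard]
          ring
  have htri : (n ^ 3 - 3 * n ^ 2) * u ^ 3 ≤
      ∑ G, ν G * ∑ i, ∑ j, ∑ k, adjReal G i j * adjReal G j k * adjReal G k i := by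
    have h1 : ∀ i j k : Fin n, u ^ 3 * (1 - (if i = j then 1 else 0) - (if j = k then 1 else 0)
        - (if k = i then 1 else 0)) ≤
        ∑ G, ν G * (adjReal G i j * adjReal G j k * adjReal G k i) := by
      intro i j k
      by_cases hd : i = j ∨ j = k ∨ k = i
      · refine le_trans (b := 0) ?_ (Finset.sum_nonneg fun G _ => mul_nonneg (hνpos G).le
          (mul_nonneg (mul_nonneg (adjReal_mem_Icc G _ _).1 (adjReal_mem_Icc G _ _).1)
            (adjReal_mem_Icc G _ _).1))
        refine mul_nonpos_of_nonneg_of_nonpos (by positivity) ?_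
        rcases hd with hd | hd | hd
        · rw [if_pos hd]
          split_ifs <;> norm_num
        · rw [if_pos hd]
          split_ifs <;> norm_num
        · rw [if_pos hd]
          split_ifs <;> norm_num
      · push Not at hd
        obtain ⟨hij, hjk, hki⟩ := hd
        have h2 := sum_productWeight_const_of_subset u (F := {s(i, j), s(j, k), s(k, i)})
          (by
            intro e he
            simp only [Finset.mem_insert, Finset.mem_singleton] at he
            rcases he with rfl | rfl | rfl <;> simpa [offDiagPairs])
        have h3 : ({s(i, j), s(j, k), s(k, i)} : Finset (Sym2 (Fin n))).card ≤ 3 :=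
          Finset.card_le_three
        have h4 : ∀ G : SimpleGraph (Fin n), adjReal G i j * adjReal G j k * adjReal G k i
            = if ∀ e ∈ ({s(i, j), s(j, k), s(k, i)} : Finset (Sym2 (Fin n))), e ∈ G.edgeSet
              then 1 else 0 := by
          intro G
          simp only [Finset.mem_insert, Finset.mem_singleton, forall_eq_or_imp, forall_eq,
            SimpleGraph.mem_edgeSet, adjReal]
          split_ifs <;> simp_all
        simp_rw [h4]
        rw [h2]
        simp only [hij, hjk, hki, if_false, sub_zero, mul_one]
        exact pow_le_pow_of_le_one hu0.le hu1.le h3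
    calc (n ^ 3 - 3 * n ^ 2) * u ^ 3
        = ∑ i : Fin n, ∑ j : Fin n, ∑ k : Fin n, u ^ 3 * (1 - (if i = j then 1 else 0)
          - (if j = k then 1 else 0) - (if k = i then 1 else 0)) := by
          simp_rw [← Finset.mul_sum, Finset.sum_sub_distrib]
          simp
          ring
      _ ≤ ∑ i, ∑ j, ∑ k, ∑ G, ν G * (adjReal G i j * adjReal G j k * adjReal G k i) :=
          Finset.sum_le_sum fun i _ => Finset.sum_le_sum fun j _ =>
            Finset.sum_le_sum fun k _ => h1 i j k
      _ = _ := by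
          simp_rw [Finset.mul_sum]
          rw [Finset.sum_comm (s := (Finset.univ : Finset (SimpleGraph (Fin n))))]
          refine Finset.sum_congr rfl fun i _ => ?_
          rw [Finset.sum_comm (s := (Finset.univ : Finset (SimpleGraph (Fin n))))]
          refine Finset.sum_congr rfl fun j _ => ?_
          rw [Finset.sum_comm (s := (Finset.univ : Finset (SimpleGraph (Fin n))))]
  have hlog : ∑ G, ν G * Real.log (ν G)
      = (n ^ 2 - n) / 2 * (u * Real.log u + (1 - u) * Real.log (1 - u)) := by
    calc _ = ∑ G, ∑ e ∈ offDiagPairs n,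
          (ν G * (if e ∈ G.edgeSet then (1 : ℝ) else 0) * (Real.log u - Real.log (1 - u)) +
            ν G * Real.log (1 - u)) := by
          refine Finset.sum_congr rfl fun G _ => ?_
          rw [hν, log_productWeight (hfac G), Finset.mul_sum]
          exact Finset.sum_congr rfl fun e _ => by ring
      _ = ∑ e ∈ offDiagPairs n, (u * Real.log u + (1 - u) * Real.log (1 - u)) := by
          rw [Finset.sum_comm]
          refine Finset.sum_congr rfl fun e he => ?_
          rw [Finset.sum_add_distrib, ← Finset.sum_mul, ← Finset.sum_mul, hone e he, hν1]
          ring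
      _ = _ := by
          rw [Finset.sum_const, nsmul_eq_mul, hcard]
  set Y : SimpleGraph (Fin n) → ℝ := fun G => α / (6 * n) *
    (∑ i, ∑ j, ∑ k, adjReal G i j * adjReal G j k * adjReal G k i) +
      h / 2 * (∑ i, ∑ j, adjReal G i j) - Real.log (ν G) with hY
  set m := ∑ G, ν G * Y G with hm
  have hm' : n ^ 2 * gFun α h u - n * (α / 2 * u ^ 3 + h / 2 * u
      - (u * Real.log u + (1 - u) * Real.log (1 - u)) / 2) ≤ m := by
    have h1 : m = α / (6 * n) * (∑ G, ν G *
        ∑ i, ∑ j, ∑ k, adjReal G i j * adjReal G j k * adjReal G k i) +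
          h / 2 * (∑ G, ν G * ∑ i, ∑ j, adjReal G i j) - ∑ G, ν G * Real.log (ν G) := by
      rw [hm, Finset.mul_sum, Finset.mul_sum, ← Finset.sum_add_distrib, ← Finset.sum_sub_distrib]
      refine Finset.sum_congr rfl fun G _ => ?_
      simp only [hY]
      ring
    rw [h1, hedge, hlog]
    have h2 := mul_le_mul_of_nonneg_left htri (show 0 ≤ α / (6 * n) by positivity)
    have h3 : α / (6 * n) * ((n ^ 3 - 3 * n ^ 2) * u ^ 3)
        = α / 6 * u ^ 3 * n ^ 2 - n * (α / 2 * u ^ 3) := by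
      field_simp
      ring
    rw [gFun]
    rw [h3] at h2
    nlinarith
  refine (Real.exp_le_exp.2 hm').trans ?_
  have hw : ∀ G, gibbsWeight α h G = Real.exp m * (ν G * Real.exp (Y G - m)) := by
    intro G
    have : Real.exp m * (ν G * Real.exp (Y G - m)) = ν G * Real.exp (Y G) := by
      rw [Real.exp_sub]
      field_simp
    rw [this, hY]
    simp only
    rw [Real.exp_sub, Real.exp_log (hνpos G), ← gibbsWeight_eq]
    have := (hνpos G).ne'
    field_simp
  simp_rw [hw, ← Finset.mul_sum]
  refine le_mul_of_one_le_right (Real.exp_pos _).le ?_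
  calc (1 : ℝ) = ∑ G, ν G * (1 + (Y G - m)) := by
        have : ∑ G, ν G * (1 + (Y G - m)) = ∑ G, ν G + ∑ G, ν G * Y G - (∑ G, ν G) * m := by
          rw [Finset.sum_mul, ← Finset.sum_add_distrib, ← Finset.sum_sub_distrib]
          exact Finset.sum_congr rfl fun G _ => by ring
        rw [this, hν1, ← hm]
        ring
    _ ≤ _ := Finset.sum_le_sum fun G _ => mul_le_mul_of_nonneg_left
        (by linarith [Real.add_one_le_exp (Y G - m)]) (hνpos G).le

lemma sum_sum_update {V ι : Type*} [Fintype V] [Fintype ι] (f : (V → ι) → ℝ) (a : V) :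
    ∑ φ : V → ι, ∑ i, f (Function.update φ a i) = Fintype.card ι * ∑ φ, f φ := by
  have hupd : ∀ (c : ι × ({j // j ≠ a} → ι)) (i : ι),
      Function.update ((Equiv.funSplitAt a ι).symm c) a i = (Equiv.funSplitAt a ι).symm (i, c.2) := by
    intro c i
    ext v
    by_cases hv : v = a
    · subst hv
      simp [Equiv.funSplitAt]
    · simp [Equiv.funSplitAt, hv]
  rw [← (Equiv.funSplitAt a ι).symm.sum_comp, ← (Equiv.funSplitAt a ι).symm.sum_comp]
  simp_rw [hupd]
  rw [Fintype.sum_prod_type, Fintype.sum_prod_type]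
  simp only [Finset.sum_const, Finset.card_univ, nsmul_eq_mul]
  rw [Finset.sum_comm]

lemma abs_sum_cut_edge_mul_prod_le {V : Type*} [Fintype V] {n : ℕ} (hn : 0 < n)
    {X : Sym2 (Fin n) → ℝ} {u η : ℝ} (hX : ∀ e, X e ∈ Set.Icc (0 : ℝ) 1)
    (hcut : CutBound (fun i j => X s(i, j) - u) (η * n ^ 2)) {a b : V} (hab : a ≠ b)
    {F : Finset (Sym2 V)} (hF : s(a, b) ∉ F) :
    |∑ φ : V → Fin n, (X s(φ a, φ b) - u) * ∏ e ∈ F, X (e.map φ)| ≤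
      η * (n : ℝ) ^ Fintype.card V := by
  set f : (V → Fin n) → ℝ := fun φ => (X s(φ a, φ b) - u) * ∏ e ∈ F, X (e.map φ) with hf
  have hn' : (0 : ℝ) < n := by exact_mod_cast hn
  have havg : (n : ℝ) ^ 2 * ∑ φ, f φ
      = ∑ φ : V → Fin n, ∑ i, ∑ j, f (Function.update (Function.update φ a i) b j) := by
    rw [sum_sum_update (fun φ => ∑ j, f (Function.update φ b j)) a, sum_sum_update f b,
      Fintype.card_fin]
    ring
  have hprod : ∀ (G : Finset (Sym2 V)) φ, ∏ e ∈ G, X (Sym2.map φ e) ∈ Set.Icc (0 : ℝ) 1 :=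
    fun G φ => ⟨Finset.prod_nonneg fun e _ => (hX _).1,
      Finset.prod_le_one (fun e _ => (hX _).1) fun e _ => (hX _).2⟩
  have hcongr : ∀ (e : Sym2 V) (φ ψ : V → Fin n), (∀ v ∈ e, φ v = ψ v) → e.map φ = e.map ψ := by
    intro e φ ψ h
    exact Sym2.map_congr h
  have hbound : ∀ φ : V → Fin n,
      |∑ i, ∑ j, f (Function.update (Function.update φ a i) b j)| ≤ η * n ^ 2 := by
    intro φ
    have hsplit : ∀ i j, f (Function.update (Function.update φ a i) b j)
        = (X s(i, j) - u) * (∏ e ∈ F.filter (fun e => ¬ b ∈ e), X (e.map (Function.update φ a i)))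
          * ∏ e ∈ F.filter (fun e => b ∈ e), X (e.map (Function.update φ b j)) := by
      intro i j
      have h1 : ∏ e ∈ F.filter (fun e => ¬ b ∈ e),
          X (e.map (Function.update (Function.update φ a i) b j))
          = ∏ e ∈ F.filter (fun e => ¬ b ∈ e), X (e.map (Function.update φ a i)) := by
        refine Finset.prod_congr rfl fun e he => ?_
        rw [hcongr e _ (Function.update φ a i)]
        intro v hv
        have : v ≠ b := by
          rintro rfl
          exact (Finset.mem_filter.1 he).2 hv
        simp [this]
      have h2 : ∏ e ∈ F.filter (fun e => b ∈ e),
          X (e.map (Function.update (Function.update φ a i) b j))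
          = ∏ e ∈ F.filter (fun e => b ∈ e), X (e.map (Function.update φ b j)) := by
        refine Finset.prod_congr rfl fun e he => ?_
        rw [hcongr e _ (Function.update φ b j)]
        intro v hv
        have : v ≠ a := by
          rintro rfl
          have := (Sym2.mem_and_mem_iff hab).1 ⟨hv, (Finset.mem_filter.1 he).2⟩
          exact hF (this ▸ (Finset.mem_filter.1 he).1)
        by_cases hvb : v = b
        · simp [hvb]
        · simp [this, hvb]
      simp only [hf]
      rw [← Finset.prod_filter_mul_prod_filter_not F (fun e => b ∈ e), h1, h2]
      simp only [Function.update_self, Function.update_of_ne hab]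
      ring
    simp_rw [hsplit]
    exact hcut.abs_sum_mul_mul_le (fun i => hprod _ _) (fun j => hprod _ _)
  have h3 : |(n : ℝ) ^ 2 * ∑ φ, f φ| ≤ (n : ℝ) ^ Fintype.card V * (η * n ^ 2) := by
    rw [havg]
    refine (Finset.abs_sum_le_sum_abs _ _).trans ?_
    refine (Finset.sum_le_sum fun φ _ => hbound φ).trans (le_of_eq ?_)
    simp
  rw [abs_mul, abs_of_pos (by positivity : (0 : ℝ) < (n : ℝ) ^ 2)] at h3
  have h4 : (0 : ℝ) < (n : ℝ) ^ 2 := by positivity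
  nlinarith

/-- Counting lemma: homomorphism sums of a matrix that is cut-close to a constant. -/
lemma abs_sum_prod_sub_pow_le {V : Type*} [Fintype V] {n : ℕ} (hn : 0 < n)
    {X : Sym2 (Fin n) → ℝ} {u η : ℝ} (hX : ∀ e, X e ∈ Set.Icc (0 : ℝ) 1)
    (hu : u ∈ Set.Icc (0 : ℝ) 1)
    (hcut : CutBound (fun i j => X s(i, j) - u) (η * n ^ 2)) (F : Finset (Sym2 V))
    (hF : ∀ e ∈ F, ¬ e.IsDiag) :
    |∑ φ : V → Fin n, ∏ e ∈ F, X (e.map φ) - u ^ F.card * (n : ℝ) ^ Fintype.card V| ≤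
      F.card * η * (n : ℝ) ^ Fintype.card V := by
  induction F using Finset.induction_on with
  | empty => simp
  | insert e F he ih =>
    have ih' := ih fun e he => hF e (Finset.mem_insert_of_mem he)
    have hed := hF e (Finset.mem_insert_self _ _)
    induction e with
    | _ a b =>
    have hab : a ≠ b := by simpa using hed
    have h1 := abs_sum_cut_edge_mul_prod_le hn hX hcut hab he
    have h2 : ∑ φ : V → Fin n, ∏ e ∈ insert s(a, b) F, X (e.map φ)
        - u ^ (insert s(a, b) F).card * (n : ℝ) ^ Fintype.card V
        = ∑ φ : V → Fin n, (X s(φ a, φ b) - u) * ∏ e ∈ F, X (e.map φ)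
          + u * (∑ φ : V → Fin n, ∏ e ∈ F, X (e.map φ)
            - u ^ F.card * (n : ℝ) ^ Fintype.card V) := by
      rw [Finset.card_insert_of_notMem he]
      simp_rw [Finset.prod_insert he, sub_mul, Finset.sum_sub_distrib, Sym2.map_mk,
        ← Finset.mul_sum]
      ring
    rw [h2, Finset.card_insert_of_notMem he]
    refine (abs_add_le _ _).trans ?_
    rw [abs_mul, abs_of_nonneg hu.1]
    have h3 := mul_le_mul hu.2 ih' (abs_nonneg _) zero_le_one
    push_cast
    nlinarith

lemma card_hom_eq_sum {V : Type} [Fintype V] (H : SimpleGraph V) {n : ℕ}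
    (G : SimpleGraph (Fin n)) :
    (Nat.card (H →g G) : ℝ) = ∑ φ : V → Fin n,
      ∏ e ∈ Finset.univ.filter (fun e => e ∈ H.edgeSet),
        (if Sym2.map φ e ∈ G.edgeSet then (1 : ℝ) else 0) := by
  have h1 : ∀ φ : V → Fin n, ∏ e ∈ Finset.univ.filter (fun e => e ∈ H.edgeSet),
      (if Sym2.map φ e ∈ G.edgeSet then (1 : ℝ) else 0)
      = if ∀ a b, H.Adj a b → G.Adj (φ a) (φ b) then 1 else 0 := by
    intro φ
    split_ifs with h
    · refine Finset.prod_eq_one fun e he => ?_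
      induction e with
      | _ a b =>
      have : H.Adj a b := by simpa using he
      simp [h a b this]
    · push Not at h
      obtain ⟨a, b, hab, hG⟩ := h
      exact Finset.prod_eq_zero (i := s(a, b)) (by simpa using hab) (by simp [hG])
  simp_rw [h1]
  rw [Finset.sum_boole, ← Fintype.card_subtype, ← Nat.card_eq_fintype_card]
  congr 1
  exact Nat.card_congr ⟨fun f => ⟨f, fun a b hab => f.map_rel hab⟩,
    fun f => ⟨f.1, fun {a b} hab => f.2 a b hab⟩, fun f => rfl, fun f => rfl⟩

lemma abs_homDensity_sub_pow_le {V : Type} [Fintype V] (H : SimpleGraph V) {n : ℕ} (hn : 0 < n)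
    (G : SimpleGraph (Fin n)) {u η : ℝ} (hu : u ∈ Set.Icc (0 : ℝ) 1)
    (hcut : CutBound (fun i j => adjReal G i j - u) (η * n ^ 2)) :
    |homDensity H G - u ^ edgeNum H| ≤ edgeNum H * η := by
  have hn' : (0 : ℝ) < n := by exact_mod_cast hn
  have hcard : (Finset.univ.filter (fun e => e ∈ H.edgeSet)).card = edgeNum H := by
    rw [edgeNum, Nat.card_eq_fintype_card, ← Fintype.card_subtype]
  have h := abs_sum_prod_sub_pow_le hn (X := fun e => if e ∈ G.edgeSet then 1 else 0)
    (fun e => by split_ifs <;> simp) hu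
    (by simpa only [adjReal_eq_indicator] using hcut)
    (Finset.univ.filter (fun e => e ∈ H.edgeSet))
    (fun e he => H.not_isDiag_of_mem_edgeSet (by simpa using he))
  rw [← card_hom_eq_sum, hcard] at h
  have hpos : (0 : ℝ) < (n : ℝ) ^ Fintype.card V := by positivity
  have h2 : homDensity H G - u ^ edgeNum H
      = ((Nat.card (H →g G) : ℝ) - u ^ edgeNum H * (n : ℝ) ^ Fintype.card V)
        / (n : ℝ) ^ Fintype.card V := by
    rw [homDensity]
    field_simp
  rw [h2, abs_div, abs_of_pos hpos, div_le_iff₀ hpos]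
  exact h

lemma gFun_eq_binEntropy (α h u : ℝ) :
    gFun α h u = α / 6 * u ^ 3 + h / 2 * u + Real.binEntropy u / 2 := by
  rw [gFun, Real.binEntropy, Real.log_inv, Real.log_inv]
  ring

lemma continuous_gFun (α h : ℝ) : Continuous (gFun α h) := by
  have : gFun α h = fun u => α / 6 * u ^ 3 + h / 2 * u + Real.binEntropy u / 2 := by
    ext u
    exact gFun_eq_binEntropy α h u
  rw [this]
  fun_prop

/-- For nonpositive `α` the energy is strictly concave, so two maximizers force `α > 0`. -/
lemma pos_of_two_maximizers {α h u₁ u₂ : ℝ} (h0 : 0 < u₁) (h12 : u₁ < u₂) (h1 : u₂ < 1)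
    (hmax : ∀ u ∈ Set.Icc (0 : ℝ) 1, gFun α h u ≤ gFun α h u₁)
    (heq : gFun α h u₂ = gFun α h u₁) : 0 < α := by
  by_contra hα
  push Not at hα
  obtain ⟨-, hconc⟩ := Real.strictConcave_binEntropy
  have hent := hconc ⟨h0.le, h12.le.trans h1.le⟩ ⟨h0.le.trans h12.le, h1.le⟩ h12.ne
    (one_half_pos (α := ℝ)) (one_half_pos (α := ℝ)) (add_halves 1)
  have hm := hmax (1 / 2 * u₁ + 1 / 2 * u₂) ⟨by linarith, by linarith⟩
  simp only [smul_eq_mul] at hent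
  have hcube : (1 / 2 * u₁ + 1 / 2 * u₂) ^ 3 ≤ 1 / 2 * u₁ ^ 3 + 1 / 2 * u₂ ^ 3 := by
    nlinarith [mul_nonneg (by linarith : 0 ≤ u₁ + u₂) (sq_nonneg (u₁ - u₂))]
  rw [gFun_eq_binEntropy, gFun_eq_binEntropy] at hm heq
  nlinarith

/-- Distance to the pair of maximizers. -/
noncomputable def distPair (u₁ u₂ v : ℝ) : ℝ := min |v - u₁| |v - u₂|

lemma distPair_nonneg (u₁ u₂ v : ℝ) : 0 ≤ distPair u₁ u₂ v :=
  le_min (abs_nonneg _) (abs_nonneg _)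

lemma exists_distPair_le {α h u₁ u₂ : ℝ} (h0 : 0 < u₁) (h12 : u₁ < u₂) (h1 : u₂ < 1)
    (hmax : ∀ u ∈ Set.Icc (0 : ℝ) 1, gFun α h u ≤ gFun α h u₁)
    (huniq : ∀ u ∈ Set.Icc (0 : ℝ) 1, gFun α h u = gFun α h u₁ → u = u₁ ∨ u = u₂)
    {η : ℝ} (hη : 0 < η) :
    ∃ c > 0, ∀ v ∈ Set.Icc (0 : ℝ) 1,
      distPair u₁ u₂ v ≤ η + (gFun α h u₁ - gFun α h v) / c := by
  have hcont : Continuous (distPair u₁ u₂) := by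
    unfold distPair
    fun_prop
  set K := Set.Icc (0 : ℝ) 1 ∩ {v | η ≤ distPair u₁ u₂ v} with hK
  have hKc : IsCompact K := isCompact_Icc.inter_right (isClosed_le continuous_const hcont)
  have hbound : ∀ v ∈ Set.Icc (0 : ℝ) 1, distPair u₁ u₂ v ≤ 1 := by
    intro v hv
    refine (min_le_left _ _).trans (abs_le.2 ⟨?_, ?_⟩)
    · linarith [hv.1]
    · linarith [hv.2]
  rcases K.eq_empty_or_nonempty with hemp | hne
  · refine ⟨1, one_pos, fun v hv => ?_⟩
    have : ¬ η ≤ distPair u₁ u₂ v := fun h => by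
      have : v ∈ K := ⟨hv, h⟩
      simp [hemp] at this
    have := hmax v hv
    push Not at *
    rw [div_one]
    linarith
  · obtain ⟨w, hw, hwmin⟩ := hKc.exists_isMinOn hne
      (continuous_const.sub (continuous_gFun α h) : Continuous fun v => gFun α h u₁ - gFun α h v).continuousOn
    have hwpos : 0 < gFun α h u₁ - gFun α h w := by
      rcases (hmax w hw.1).lt_or_eq with h | h
      · linarith
      · exfalso
        have hd : η ≤ distPair u₁ u₂ w := hw.2
        rcases huniq w hw.1 h with rfl | rfl <;> simp [distPair] at hd <;> linarith
    refine ⟨_, hwpos, fun v hv => ?_⟩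
    by_cases hd : η ≤ distPair u₁ u₂ v
    · have h2 : gFun α h u₁ - gFun α h w ≤ gFun α h u₁ - gFun α h v := hwmin ⟨hv, hd⟩
      have h3 : 1 ≤ (gFun α h u₁ - gFun α h v) / (gFun α h u₁ - gFun α h w) :=
        (one_le_div hwpos).2 h2
      linarith [hbound v hv]
    · have h3 : 0 ≤ (gFun α h u₁ - gFun α h v) / (gFun α h u₁ - gFun α h w) :=
        div_nonneg (by linarith [hmax v hv]) hwpos.le
      linarith

lemma amgm_deficit_nonneg {a b c : ℝ} (ha : 0 ≤ a) (hb : 0 ≤ b) (hc : 0 ≤ c) :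
    0 ≤ a ^ 3 + b ^ 3 + c ^ 3 - 3 * (a * b * c) := by
  nlinarith [mul_nonneg (by linarith : 0 ≤ a + b + c) (sq_nonneg (a - b)),
    mul_nonneg (by linarith : 0 ≤ a + b + c) (sq_nonneg (b - c)),
    mul_nonneg (by linarith : 0 ≤ a + b + c) (sq_nonneg (c - a))]

lemma mul_sq_sub_le_amgm_deficit {a b c : ℝ} (ha : 0 ≤ a) (hb : 0 ≤ b) (hc : 0 ≤ c) :
    a * (a - b) ^ 2 ≤ 2 * (a ^ 3 + b ^ 3 + c ^ 3 - 3 * (a * b * c)) := by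
  nlinarith [mul_nonneg (by linarith : 0 ≤ b + c) (sq_nonneg (a - b)),
    mul_nonneg (by linarith : 0 ≤ a + b + c) (sq_nonneg (b - c)),
    mul_nonneg (by linarith : 0 ≤ a + b + c) (sq_nonneg (c - a))]

lemma sum_sum_le_of_forall_le {n : ℕ} {f : Fin n → Fin n → ℝ} {c : ℝ} (h : ∀ i j, f i j ≤ c) :
    ∑ i, ∑ j, f i j ≤ n ^ 2 * c := by
  calc _ ≤ ∑ _i : Fin n, ∑ _j : Fin n, c :=
        Finset.sum_le_sum fun i _ => Finset.sum_le_sum fun j _ => h i j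
    _ = n ^ 2 * c := by
        simp
        ring

/-- Stability: an almost optimal matrix is `L¹`-close to one of the two constant maximizers. -/
lemma exists_stability {α h u₁ u₂ : ℝ} (h0 : 0 < u₁) (h12 : u₁ < u₂) (h1 : u₂ < 1)
    (hmax : ∀ u ∈ Set.Icc (0 : ℝ) 1, gFun α h u ≤ gFun α h u₁)
    (huniq : ∀ u ∈ Set.Icc (0 : ℝ) 1, gFun α h u = gFun α h u₁ → u = u₁ ∨ u = u₂)
    (hα : 0 < α) {η : ℝ} (hη : 0 < η) :
    ∃ c > 0, ∀ n : ℕ, 0 < n → ∀ p : Fin n → Fin n → ℝ, (∀ i j, p i j ∈ Set.Icc (0 : ℝ) 1) →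
      ∑ i, ∑ j, (gFun α h u₁ - gFun α h (p i j)) + α / (18 * n) *
        (∑ i, ∑ j, ∑ k, (p i j ^ 3 + p j k ^ 3 + p k i ^ 3 - 3 * (p i j * p j k * p k i)))
          ≤ c * n ^ 2 →
      ∃ u, (u = u₁ ∨ u = u₂) ∧ ∑ i, ∑ j, |p i j - u| ≤ η * n ^ 2 := by
  set κ := min (u₁ * η ^ 2 / 64) η with hκ
  have hκpos : 0 < κ := lt_min (by positivity) hη
  obtain ⟨c₁, hc₁, hdist⟩ := exists_distPair_le h0 h12 h1 hmax huniq
    (show 0 < κ / 4 by positivity)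
  refine ⟨min (c₁ * κ / 4) (α * κ / 72), lt_min (by positivity) (by positivity), ?_⟩
  intro n hn p hp hdef
  set c := min (c₁ * κ / 4) (α * κ / 72) with hc
  have hn' : (0 : ℝ) < n := by exact_mod_cast hn
  set g := ∑ i, ∑ j, (gFun α h u₁ - gFun α h (p i j)) with hg
  set D := ∑ i, ∑ j, ∑ k,
    (p i j ^ 3 + p j k ^ 3 + p k i ^ 3 - 3 * (p i j * p j k * p k i)) with hD
  have hg0 : 0 ≤ g := Finset.sum_nonneg fun i _ => Finset.sum_nonneg fun j _ => by
    linarith [hmax _ (hp i j)]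
  have hD0 : 0 ≤ D := Finset.sum_nonneg fun i _ => Finset.sum_nonneg fun j _ =>
    Finset.sum_nonneg fun k _ => amgm_deficit_nonneg (hp i j).1 (hp j k).1 (hp k i).1
  clear_value g D c
  have hDt : 0 ≤ α / (18 * n) * D := mul_nonneg (by positivity) hD0
  -- both deficits are small
  have hgs : g / c₁ ≤ κ / 4 * n ^ 2 := by
    rw [div_le_iff₀ hc₁]
    have : c * n ^ 2 ≤ c₁ * κ / 4 * n ^ 2 := by
      gcongr
      exact hc.trans_le (min_le_left _ _)
    linarith
  have hDs : D ≤ κ / 4 * n ^ 3 := by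
    have h2 : c * n ^ 2 ≤ α * κ / 72 * n ^ 2 := by
      gcongr
      exact hc.trans_le (min_le_right _ _)
    have h3 : α / (18 * n) * D ≤ α * κ / 72 * n ^ 2 := by linarith
    have h5 : α * κ / 72 * n ^ 2 = α / (18 * n) * (κ / 4 * n ^ 3) := by
      field_simp
      ring
    rw [h5] at h3
    exact le_of_mul_le_mul_left h3 (by positivity)
  set S := ∑ i, ∑ j, distPair u₁ u₂ (p i j) with hS
  have hSs : S ≤ κ / 2 * n ^ 2 := by
    calc S ≤ ∑ i, ∑ j, (κ / 4 + (gFun α h u₁ - gFun α h (p i j)) / c₁) :=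
          Finset.sum_le_sum fun i _ => Finset.sum_le_sum fun j _ => hdist _ (hp i j)
      _ = n ^ 2 * (κ / 4) + g / c₁ := by
          simp_rw [Finset.sum_add_distrib, ← Finset.sum_div]
          rw [← hg]
          simp
          ring
      _ ≤ _ := by linarith
  -- neighbouring entries are close on average
  have hpt : ∀ i j k, |p i j - p j k| ≤ η / 8 + 8 / (η * u₁) *
      (2 * (p i j ^ 3 + p j k ^ 3 + p k i ^ 3 - 3 * (p i j * p j k * p k i))
        + distPair u₁ u₂ (p i j)) := by
    intro i j k
    have h2 := mul_sq_sub_le_amgm_deficit (hp i j).1 (hp j k).1 (hp k i).1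
    have h3 : u₁ ≤ p i j + distPair u₁ u₂ (p i j) := by
      rcases min_choice |p i j - u₁| |p i j - u₂| with h | h
      · rw [distPair, h]
        linarith [neg_abs_le (p i j - u₁)]
      · rw [distPair, h]
        linarith [neg_abs_le (p i j - u₂)]
    have h4 : (p i j - p j k) ^ 2 ≤ 1 := by
      have := (hp i j).1
      have := (hp i j).2
      have := (hp j k).1
      have := (hp j k).2
      nlinarith
    have h5 : u₁ * (p i j - p j k) ^ 2 ≤
        2 * (p i j ^ 3 + p j k ^ 3 + p k i ^ 3 - 3 * (p i j * p j k * p k i))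
          + distPair u₁ u₂ (p i j) := by
      have h6 := mul_le_mul_of_nonneg_right h3 (sq_nonneg (p i j - p j k))
      have h7 := mul_le_mul_of_nonneg_left h4 (distPair_nonneg u₁ u₂ (p i j))
      nlinarith
    have h8 : |p i j - p j k| ≤ η / 8 + 8 / (η * u₁) * (u₁ * (p i j - p j k) ^ 2) := by
      have h9 : 8 / (η * u₁) * (u₁ * (p i j - p j k) ^ 2) = (p i j - p j k) ^ 2 / (η / 8) := by
        field_simp
      rw [h9, ← sq_abs]
      set y := |p i j - p j k|
      by_cases hy : y ≤ η / 8
      · have : 0 ≤ y ^ 2 / (η / 8) := by positivity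
        linarith
      · push Not at hy
        have : y ≤ y ^ 2 / (η / 8) := by
          rw [le_div_iff₀ (by positivity)]
          nlinarith
        linarith
    refine h8.trans ?_
    gcongr
  have hadj : ∑ i, ∑ j, ∑ k, |p i j - p j k| ≤ η / 4 * n ^ 3 := by
    calc _ ≤ ∑ i, ∑ j, ∑ k, (η / 8 + 8 / (η * u₁) *
          (2 * (p i j ^ 3 + p j k ^ 3 + p k i ^ 3 - 3 * (p i j * p j k * p k i))
            + distPair u₁ u₂ (p i j))) :=
          Finset.sum_le_sum fun i _ => Finset.sum_le_sum fun j _ =>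
            Finset.sum_le_sum fun k _ => hpt i j k
      _ = n ^ 3 * (η / 8) + 8 / (η * u₁) * (2 * D + n * S) := by
          have hS' : ∑ i, ∑ j, ∑ _k : Fin n, distPair u₁ u₂ (p i j) = n * S := by
            simp [hS, Finset.mul_sum]
          simp_rw [Finset.sum_add_distrib, ← Finset.mul_sum, Finset.sum_add_distrib,
            ← Finset.mul_sum]
          rw [hS', ← hD]
          simp
          ring
      _ ≤ n ^ 3 * (η / 8) + 8 / (η * u₁) * (u₁ * η ^ 2 / 64 * n ^ 3) := by
          have hκ1 : κ ≤ u₁ * η ^ 2 / 64 := min_le_left _ _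
          have h2 : 2 * D + n * S ≤ κ * n ^ 3 := by nlinarith
          have h3 : κ * n ^ 3 ≤ u₁ * η ^ 2 / 64 * n ^ 3 := by gcongr
          gcongr
          linarith
      _ = _ := by
          field_simp
          ring
  have hpairs : ∑ k, ∑ l, (∑ i, ∑ j, |p i j - p k l| + n ^ 2 * distPair u₁ u₂ (p k l))
      ≤ η * n ^ 4 := by
    have h2 : ∑ k, ∑ l, ∑ i, ∑ j, |p i j - p k l| ≤ η / 2 * n ^ 4 := by
      have e1 : ∑ k, ∑ _l : Fin n, ∑ i, ∑ j, |p i j - p j k| = n * ∑ i, ∑ j, ∑ k, |p i j - p j k| := by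
        simp only [Finset.sum_const, Finset.card_univ, Fintype.card_fin, nsmul_eq_mul]
        rw [← Finset.mul_sum, Finset.sum_comm]
        congr 1
        exact Finset.sum_congr rfl fun i _ => Finset.sum_comm
      have e2 : ∑ k, ∑ l, ∑ i : Fin n, ∑ j, |p j k - p k l|
          = n * ∑ i, ∑ j, ∑ k, |p i j - p j k| := by
        simp only [Finset.sum_const, Finset.card_univ, Fintype.card_fin, nsmul_eq_mul]
        simp_rw [← Finset.mul_sum]
        congr 1
        rw [show ∑ k, ∑ l, ∑ j, |p j k - p k l| = ∑ k, ∑ j, ∑ l, |p j k - p k l| from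
          Finset.sum_congr rfl fun k _ => Finset.sum_comm, Finset.sum_comm]
      calc _ ≤ ∑ k, ∑ l, ∑ i, ∑ j, (|p i j - p j k| + |p j k - p k l|) :=
            Finset.sum_le_sum fun k _ => Finset.sum_le_sum fun l _ =>
              Finset.sum_le_sum fun i _ => Finset.sum_le_sum fun j _ => abs_sub_le _ _ _
        _ = 2 * (n * ∑ i, ∑ j, ∑ k, |p i j - p j k|) := by
            simp_rw [Finset.sum_add_distrib]
            rw [e1, e2]
            ring
        _ ≤ 2 * (n * (η / 4 * n ^ 3)) := by gcongr
        _ = _ := by ring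
    have h3 : ∑ k, ∑ l, (n : ℝ) ^ 2 * distPair u₁ u₂ (p k l) ≤ η / 2 * n ^ 4 := by
      simp_rw [← Finset.mul_sum]
      rw [← hS]
      have hκ2 : κ ≤ η := min_le_right _ _
      calc (n : ℝ) ^ 2 * S ≤ n ^ 2 * (κ / 2 * n ^ 2) := by gcongr
        _ ≤ n ^ 2 * (η / 2 * n ^ 2) := by gcongr
        _ = _ := by ring
    simp_rw [Finset.sum_add_distrib]
    linarith
  obtain ⟨k, l, hkl⟩ : ∃ k l,
      ∑ i, ∑ j, |p i j - p k l| + n ^ 2 * distPair u₁ u₂ (p k l) ≤ η * n ^ 2 := by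
    by_contra hcon
    push Not at hcon
    have h2 : η * n ^ 4 < ∑ k, ∑ l,
        (∑ i, ∑ j, |p i j - p k l| + n ^ 2 * distPair u₁ u₂ (p k l)) := by
      have hne : (Finset.univ : Finset (Fin n)).Nonempty := ⟨⟨0, hn⟩, Finset.mem_univ _⟩
      calc η * n ^ 4 = ∑ _k : Fin n, ∑ _l : Fin n, η * (n : ℝ) ^ 2 := by
            simp
            ring
        _ < _ := Finset.sum_lt_sum_of_nonempty hne fun k _ =>
            Finset.sum_lt_sum_of_nonempty hne fun l _ => hcon k l
    linarith
  obtain ⟨u, hu, hdu⟩ : ∃ u, (u = u₁ ∨ u = u₂) ∧ distPair u₁ u₂ (p k l) = |p k l - u| := by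
    rcases min_choice |p k l - u₁| |p k l - u₂| with h | h
    · exact ⟨u₁, Or.inl rfl, h⟩
    · exact ⟨u₂, Or.inr rfl, h⟩
  refine ⟨u, hu, le_trans ?_ hkl⟩
  rw [hdu]
  calc _ ≤ ∑ i, ∑ j, (|p i j - p k l| + |p k l - u|) :=
        Finset.sum_le_sum fun i _ => Finset.sum_le_sum fun j _ => abs_sub_le _ _ _
    _ = _ := by
        simp_rw [Finset.sum_add_distrib]
        simp
        ring

/-- Total Gibbs weight of the graphs in `A` when every cut-class inside `A` has weight at most `w`. -/
lemma sum_gibbsWeight_le_card_cutNet_mul {n : ℕ} {α h δ w : ℝ} {k : ℕ} (hδ : 0 < δ)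
    (hk : 1 < k * δ ^ 2) (A : Finset (SimpleGraph (Fin n)))
    (hw : ∀ W : Fin n → Fin n → ℝ, ∑ G ∈ A.filter
      (fun G => CutBound (fun i j => adjReal G i j - W i j) (δ * n ^ 2)), gibbsWeight α h G ≤ w) :
    ∑ G ∈ A, gibbsWeight α h G ≤ (cutNet n δ k).card * w := by
  have hcover : ∀ G ∈ A, gibbsWeight α h G ≤ ∑ W ∈ cutNet n δ k,
      if CutBound (fun i j => adjReal G i j - W i j) (δ * n ^ 2) then gibbsWeight α h G else 0 := by
    intro G _
    obtain ⟨W, hW, hcut⟩ := exists_mem_cutNet hδ (adjReal G) (by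
      have := sum_sum_le_of_forall_le (f := fun i j => adjReal G i j ^ 2) (c := 1) fun i j => by
        have := adjReal_mem_Icc G i j
        nlinarith [this.1, this.2]
      simpa using this) hk
    have h1 := Finset.single_le_sum (f := fun W : Fin n → Fin n → ℝ =>
      if CutBound (fun i j => adjReal G i j - W i j) (δ * n ^ 2) then gibbsWeight α h G else 0)
      (fun W _ => by split_ifs <;> simp [(gibbsWeight_pos α h G).le]) hW
    simpa only [if_pos hcut] using h1
  refine (Finset.sum_le_sum hcover).trans ?_
  rw [Finset.sum_comm, ← nsmul_eq_mul]
  refine Finset.sum_le_card_nsmul _ _ _ fun W _ => ?_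
  rw [← Finset.sum_filter]
  exact hw W

lemma card_cutNet_le_exp {n : ℕ} (hn : 0 < n) (δ : ℝ) (k : ℕ) :
    ((cutNet n δ k).card : ℝ) ≤ Real.exp (n * (k * Real.log 12)) := by
  have h1 : (cutNet n δ k).card ≤ (12 ^ n) ^ k := by
    refine (card_cutNet_le n δ k).trans (Nat.pow_le_pow_left ?_ k)
    calc 3 * 4 ^ n ≤ 3 ^ n * 4 ^ n := Nat.mul_le_mul_right _ (Nat.le_self_pow hn.ne' 3)
      _ = 12 ^ n := by
        rw [← mul_pow]
        norm_num
  have h2 : Real.exp (n * (k * Real.log 12)) = ((12 : ℝ) ^ n) ^ k := by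
    rw [← pow_mul, ← Real.exp_log (show (0 : ℝ) < 12 ^ (n * k) by positivity), Real.log_pow]
    push_cast
    ring_nf
  rw [h2]
  exact_mod_cast h1

lemma gibbsProb_eq_one_sub (α h : ℝ) (n : ℕ) (A : Set (SimpleGraph (Fin n))) :
    gibbsProb α h n A = 1 - (∑ G ∈ Finset.univ.filter (fun G => G ∉ A), gibbsWeight α h G) /
      ∑ G : SimpleGraph (Fin n), gibbsWeight α h G := by
  have hpos : 0 < ∑ G : SimpleGraph (Fin n), gibbsWeight α h G :=
    Finset.sum_pos (fun G _ => gibbsWeight_pos α h G) ⟨⊥, Finset.mem_univ _⟩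
  rw [gibbsProb, eq_sub_iff_add_eq, ← add_div, div_eq_one_iff_eq hpos.ne', ← Finset.sum_filter]
  exact Finset.sum_filter_add_sum_filter_not _ _ _

/-- Concentration of a general homomorphism density on the critical curve, where the
energy function has exactly two maximizers `0 < u₁ < u₂ < 1`. -/
theorem edge_triangle_homDensity_concentration_two_maximizers
    {V : Type} [Fintype V] (H : SimpleGraph V)
    (α h : ℝ) (hα : α > -2) (u₁ u₂ : ℝ)
    (h0 : 0 < u₁) (h12 : u₁ < u₂) (h1 : u₂ < 1)
    (hmax : ∀ u ∈ Set.Icc (0 : ℝ) 1, gFun α h u ≤ gFun α h u₁)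
    (heq : gFun α h u₂ = gFun α h u₁)
    (huniq : ∀ u ∈ Set.Icc (0 : ℝ) 1, gFun α h u = gFun α h u₁ → u = u₁ ∨ u = u₂) :
    ∃ ε₀ > 0, ∀ ε, 0 < ε → ε ≤ ε₀ → ∃ τ > 0, ∃ N : ℕ, ∀ n ≥ N,
      1 - Real.exp (-τ * (n : ℝ) ^ 2) ≤
        gibbsProb α h n
          {G : SimpleGraph (Fin n) | homDensity H G ∈
            Set.Ioo (u₁ ^ (edgeNum H) - ε) (u₁ ^ (edgeNum H) + ε) ∪
            Set.Ioo (u₂ ^ (edgeNum H) - ε) (u₂ ^ (edgeNum H) + ε)} := by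
  have hα' : 0 < α := pos_of_two_maximizers h0 h12 h1 hmax heq
  refine ⟨1, one_pos, fun ε hε _ => ?_⟩
  set m := edgeNum H with hm
  set η := ε / (4 * (m + 1)) with hη
  have hηpos : 0 < η := by positivity
  obtain ⟨c, hc, hstab⟩ := exists_stability h0 h12 h1 hmax huniq hα' hηpos
  set δ := min (c / (4 * α)) η with hδ
  have hδpos : 0 < δ := lt_min (by positivity) hηpos
  obtain ⟨k, hk⟩ := exists_nat_gt (1 / δ ^ 2)
  have hk' : 1 < k * δ ^ 2 := by rwa [div_lt_iff₀ (by positivity)] at hk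
  have hclose : m * (δ + δ + η) < ε := by
    have h2 : δ ≤ η := min_le_right _ _
    have h3 : m * (δ + δ + η) ≤ m * (3 * η) := by gcongr; linarith
    have h4 : η * (4 * (m + 1)) = ε := by
      rw [hη]
      field_simp
    have h5 : (0 : ℝ) ≤ m := Nat.cast_nonneg _
    nlinarith
  have hδα : α * δ ≤ c / 4 := by
    calc α * δ ≤ α * (c / (4 * α)) := by gcongr; exact min_le_left _ _
      _ = c / 4 := by field_simp
  set K := α / 2 * u₁ ^ 3 + h / 2 * u₁
    - (u₁ * Real.log u₁ + (1 - u₁) * Real.log (1 - u₁)) / 2 with hK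
  obtain ⟨N, hN⟩ := exists_nat_ge (2 / c * (k * Real.log 12 + K))
  refine ⟨c / 4, by positivity, N + 1, fun n hnN => ?_⟩
  have hn : 0 < n := by omega
  have hn' : (0 : ℝ) < n := by exact_mod_cast hn
  have hnK : k * Real.log 12 + K ≤ c / 2 * n := by
    have h2 : (N : ℝ) ≤ n := by exact_mod_cast (by omega : N ≤ n)
    have h3 := hN.trans h2
    rw [div_mul_eq_mul_div, div_le_iff₀ hc] at h3
    linarith
  set A : Set (SimpleGraph (Fin n)) := {G : SimpleGraph (Fin n) | homDensity H G ∈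
    Set.Ioo (u₁ ^ m - ε) (u₁ ^ m + ε) ∪ Set.Ioo (u₂ ^ m - ε) (u₂ ^ m + ε)} with hA
  have hclass : ∀ W : Fin n → Fin n → ℝ, ∑ G ∈ (Finset.univ.filter (fun G => G ∉ A)).filter
      (fun G => CutBound (fun i j => adjReal G i j - W i j) (δ * n ^ 2)), gibbsWeight α h G ≤
        Real.exp (n ^ 2 * gFun α h u₁ - 3 / 4 * c * n ^ 2) := by
    intro W
    set B := (Finset.univ.filter (fun G => G ∉ A)).filter
      (fun G => CutBound (fun i j => adjReal G i j - W i j) (δ * n ^ 2)) with hB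
    rcases B.eq_empty_or_nonempty with hemp | hne
    · rw [hemp, Finset.sum_empty]
      exact (Real.exp_pos _).le
    obtain ⟨p, hp, hpW, hle⟩ := sum_gibbsWeight_le_of_cutBound hn hα' h hne (W := W)
      (δ := δ * n ^ 2) fun G hG => (Finset.mem_filter.1 hG).2
    refine hle.trans (Real.exp_le_exp.2 ?_)
    have hsum : ∑ i, ∑ j, (gFun α h u₁ - gFun α h (p i j))
        = n ^ 2 * gFun α h u₁ - ∑ i, ∑ j, gFun α h (p i j) := by
      simp_rw [Finset.sum_sub_distrib]
      simp
      ring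
    by_contra hcon
    push Not at hcon
    have hαδ : α * (δ * n ^ 2) ≤ c / 4 * n ^ 2 := by
      calc α * (δ * n ^ 2) = α * δ * n ^ 2 := by ring
        _ ≤ _ := by gcongr
    obtain ⟨u, hu, hpu⟩ := hstab n hn p hp (by rw [hsum]; linarith)
    obtain ⟨G, hG⟩ := hne
    have hGA : G ∉ A := (Finset.mem_filter.1 (Finset.mem_filter.1 hG).1).2
    have hcut : CutBound (fun i j => adjReal G i j - u) ((δ + δ + η) * n ^ 2) := by
      have h2 := ((Finset.mem_filter.1 hG).2.add hpW.neg).add (CutBound.of_sum_abs_le hpu)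
      convert h2 using 1
      · ext i j
        ring
      · ring
    have hu01 : u ∈ Set.Icc (0 : ℝ) 1 := by
      rcases hu with rfl | rfl
      · exact ⟨h0.le, h12.le.trans h1.le⟩
      · exact ⟨h0.le.trans h12.le, h1.le⟩
    have hdens := abs_lt.1 ((abs_homDensity_sub_pow_le H hn G hu01 hcut).trans_lt hclose)
    apply hGA
    have hmem : homDensity H G ∈ Set.Ioo (u ^ m - ε) (u ^ m + ε) :=
      ⟨by linarith [hdens.1], by linarith [hdens.2]⟩
    rcases hu with rfl | rfl
    · exact Or.inl hmem
    · exact Or.inr hmem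
  set Z := ∑ G : SimpleGraph (Fin n), gibbsWeight α h G with hZ
  have hZlow : Real.exp (n ^ 2 * gFun α h u₁ - n * K) ≤ Z :=
    exp_le_sum_gibbsWeight hn hα' h h0 (h12.trans h1)
  have hZpos : 0 < Z := (Real.exp_pos _).trans_le hZlow
  have hbad : ∑ G ∈ Finset.univ.filter (fun G => G ∉ A), gibbsWeight α h G ≤
      Real.exp (-(c / 4) * n ^ 2) * Z := by
    refine (sum_gibbsWeight_le_card_cutNet_mul hδpos hk' _ hclass).trans ?_
    calc _ ≤ Real.exp (n * (k * Real.log 12)) *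
          Real.exp (n ^ 2 * gFun α h u₁ - 3 / 4 * c * n ^ 2) := by
          gcongr
          exact card_cutNet_le_exp hn δ k
      _ ≤ Real.exp (-(c / 4) * n ^ 2) * Real.exp (n ^ 2 * gFun α h u₁ - n * K) := by
          rw [← Real.exp_add, ← Real.exp_add]
          refine Real.exp_le_exp.2 ?_
          have := mul_le_mul_of_nonneg_left hnK hn'.le
          linarith
      _ ≤ _ := by gcongr
  rw [gibbsProb_eq_one_sub, sub_le_sub_iff_left, div_le_iff₀ hZpos]
  refine Eq.trans_le ?_ hbad
  congr!
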